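/- Let G be a soluble-by-finite group with the property K̄∞. Then the commutator subgroup ⁅G,G⁆ of G is periodic, i.e., every element of ⁅G,G⁆ has finite order. -/

import Mathlib

/-- A group `G` has property K̄∞ if for every subgroup `X` of `G` the set of
subgroups of the form `⁅X, H⁆`, with `H` ranging over infinite subgroups of `G`,
is finite. -/
def PropKInf (G : Type*) [Group G] : Prop :=
  ∀ X : Subgroup G, {S : Subgroup G | ∃ H : Subgroup G, Infinite H ∧ S = ⁅X, H⁆}.Finite

/-- A group is soluble-by-finite if it has a solvable normal subgroup of finite index. -/
def SolubleByFinite (G : Type*) [Group G] : Prop :=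
  ∃ N : Subgroup G, N.Normal ∧ IsSolvable N ∧ N.FiniteIndex

universe u

section helpers

open scoped IsMulCommutative commutatorElement

set_option linter.style.haveILetI false

theorem isOfFinOrder_sub_coe {G : Type*} [Group G] {H : Subgroup G} {x : H} :
    IsOfFinOrder (x : G) ↔ IsOfFinOrder x :=
  Submonoid.isOfFinOrder_coe (H := H.toSubmonoid)

theorem int_jacobson : IsJacobsonRing ℤ := by
  rw [isJacobsonRing_iff_prime_eq]
  intro P hP
  by_cases h : P = ⊥
  · subst h
    rw [eq_bot_iff]
    intro x hx
    rw [Ideal.mem_jacobson_bot] at hx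
    have := hx (3 * x)
    rw [Int.isUnit_iff] at this
    rw [Ideal.mem_bot]
    rcases this with h | h
    · have : x * x = 0 := by linarith
      simpa using this
    · nlinarith [mul_self_nonneg x]
  · have := hP.isMaximal h
    exact Ideal.jacobson_eq_self_of_isMaximal

/-- A cyclic module over a finitely generated commutative ring cannot be divisible. -/
theorem divisible_zero {R M : Type*} [CommRing R] [inst : Algebra ℤ R]
    [Algebra.FiniteType ℤ R] [AddCommGroup M]
    [Module R M] (d : M) (h : ∀ q : ℕ, 0 < q → ∃ s : R, ((q : R) * s) • d = d) : d = 0 := by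
  obtain rfl : inst = Ring.toIntAlgebra R := Subsingleton.elim _ _
  by_contra hd
  set I : Ideal R := LinearMap.ker (LinearMap.toSpanSingleton R M d) with hI
  have hmem : ∀ r : R, r ∈ I ↔ r • d = 0 := fun r => by simp [hI]
  have hI1 : I ≠ ⊤ := by
    rw [Ideal.ne_top_iff_one, hmem, one_smul]; exact hd
  obtain ⟨m, hm, hIm⟩ := Ideal.exists_le_maximal I hI1
  letI : Field (R ⧸ m) := Ideal.Quotient.field m
  haveI := int_jacobson
  haveI : Algebra.FiniteType ℤ (R ⧸ m) :=
    Algebra.FiniteType.of_surjective (Ideal.Quotient.mkₐ ℤ m) (Ideal.Quotient.mkₐ_surjective ℤ m)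
  have hfin : Module.Finite ℤ (R ⧸ m) := finite_of_finite_type_of_isJacobsonRing ℤ (R ⧸ m)
  have hz : ∀ q : ℕ, (q : R ⧸ m) = 0 → q = 0 := by
    intro q hq
    by_contra hq0
    obtain ⟨s, hs⟩ := h q (Nat.pos_of_ne_zero hq0)
    have h1 : (q : R) * s - 1 ∈ I := by
      rw [hmem, sub_smul, hs, one_smul, sub_self]
    have h2 := Ideal.Quotient.eq_zero_iff_mem.mpr (hIm h1)
    simp [hq] at h2
  haveI : CharZero (R ⧸ m) := charZero_of_inj_zero hz
  refine Int.not_isField (isField_of_isIntegral_of_isField (R := ℤ) (S := R ⧸ m) ?_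
    (Field.toIsField _))
  exact (algebraMap ℤ (R ⧸ m)).injective_int

noncomputable def conjEnd {G : Type*} [Group G] (A : Subgroup G) [A.Normal] [IsMulCommutative A] :
    G →* Module.End ℤ (Additive A) where
  toFun g := ((MulAut.conjNormal g : MulAut A).toMonoidHom.toAdditive).toIntLinearMap
  map_one' := by ext x; simp
  map_mul' g h := by ext x; simp

theorem conjEnd_apply {G : Type*} [Group G] (A : Subgroup G) [A.Normal] [IsMulCommutative A]
    (g : G) (b : Additive A) :
    ((conjEnd A g b).toMul : G) = g * (b.toMul : G) * g⁻¹ := by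
  simp [conjEnd]

open LaurentPolynomial in
theorem T_sub_one_dvd (i : ℤ) : ((T 1 - 1 : LaurentPolynomial ℤ)) ∣ T i - 1 := by
  have hn : ∀ n : ℕ, ((T 1 - 1 : LaurentPolynomial ℤ)) ∣ T n - 1 := by
    intro n
    have := sub_one_dvd_pow_sub_one (T 1 : LaurentPolynomial ℤ) n
    simpa [T_pow] using this
  obtain ⟨n, rfl | rfl⟩ := i.eq_nat_or_neg
  · exact hn n
  · have : (T (-(n:ℤ)) - 1 : LaurentPolynomial ℤ) = (-T (-(n:ℤ))) * (T n - 1) := by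
      have h : (T (-(n:ℤ)) : LaurentPolynomial ℤ) * T n = 1 := by
        rw [← T_add]; simp
      linear_combination h
    rw [this]
    exact Dvd.dvd.mul_left (hn n) _

open LaurentPolynomial in
theorem step_one {G : Type*} [Group G] (hG : PropKInf G) (A : Subgroup G) [A.Normal]
    [IsMulCommutative A] (x a : G) (ha : a ∈ A) : IsOfFinOrder ⁅x, a⁆ := by
  let f : Multiplicative ℤ →* Module.End ℤ (Additive A) := (conjEnd A).comp (zpowersHom G x)
  let ρ : LaurentPolynomial ℤ →ₐ[ℤ] Module.End ℤ (Additive A) := AddMonoidAlgebra.lift ℤ _ ℤ f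
  have hρT : ∀ i : ℤ, ρ (T i) = conjEnd A (x ^ i) := by
    intro i
    have := AddMonoidAlgebra.lift_single f i (1 : ℤ)
    rw [one_smul] at this
    exact this
  letI : Module (LaurentPolynomial ℤ) (Additive A) := Module.compHom _ ρ.toRingHom
  have hsm : ∀ (r : LaurentPolynomial ℤ) (b : Additive A), r • b = ρ r b := fun _ _ => rfl
  have hT : ∀ (i : ℤ) (b : Additive A), ((T i - 1 : LaurentPolynomial ℤ) • b).toMul.val
      = ⁅x ^ i, b.toMul.val⁆ := by
    intro i b
    rw [sub_smul, one_smul, hsm, hρT, commutatorElement_def, ← conjEnd_apply]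
    simp [div_eq_mul_inv]
  let a' : Additive A := Additive.ofMul ⟨a, ha⟩
  let d : Additive A := (T 1 - 1 : LaurentPolynomial ℤ) • a'
  have hd : d.toMul.val = ⁅x, a⁆ := by
    have := hT 1 a'
    simpa [a', d] using this
  by_contra hinf
  have hainf : ¬ IsOfFinOrder a := by
    intro hf
    apply hinf
    rw [commutatorElement_def]
    have h1 : IsOfFinOrder (⟨x * a * x⁻¹, Subgroup.Normal.conj_mem ‹_› a ha x⟩ : A) := by
      rw [← isOfFinOrder_sub_coe]
      have := (MulAut.conj x).toMonoidHom.isOfFinOrder hf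
      simpa using this
    have h2 : IsOfFinOrder (⟨a⁻¹, A.inv_mem ha⟩ : A) := by
      rw [← isOfFinOrder_sub_coe]
      exact hf.inv
    have := h1.mul h2
    rw [← isOfFinOrder_sub_coe] at this
    exact this
  let X := Subgroup.zpowers x
  let D : ℕ → Subgroup G := fun n => ⁅X, Subgroup.zpowers (a ^ n.factorial)⁆
  have hDmem : ∀ n, D n ∈ {S : Subgroup G | ∃ H : Subgroup G, Infinite H ∧ S = ⁅X, H⁆} := by
    intro n
    refine ⟨_, ?_, rfl⟩
    rw [← SetLike.coe_sort_coe, Set.infinite_coe_iff, infinite_zpowers, isOfFinOrder_pow]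
    simp [hainf, n.factorial_ne_zero]
  haveI := (hG X).to_subtype
  obtain ⟨F, hF⟩ := Finite.exists_infinite_fiber
    (fun n : ℕ => (⟨D n, hDmem n⟩ :
      {S : Subgroup G | ∃ H : Subgroup G, Infinite H ∧ S = ⁅X, H⁆}))
  have hFi : {n | D n = F.1}.Infinite := by
    rw [← Set.infinite_coe_iff]
    convert hF using 3
    ext n
    simp [Subtype.ext_iff]
  obtain ⟨n₀, hn₀⟩ := hFi.nonempty
  -- elements of D n
  have hDn : ∀ n, ∀ g ∈ D n, ∃ s : LaurentPolynomial ℤ,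
      (((n.factorial : LaurentPolynomial ℤ) * s) • d).toMul.val = g := by
    intro n
    let W : Subgroup G :=
      { carrier := {g | ∃ s : LaurentPolynomial ℤ,
          (((n.factorial : LaurentPolynomial ℤ) * s) • d).toMul.val = g}
        one_mem' := ⟨0, by simp⟩
        mul_mem' := by
          rintro _ _ ⟨s, rfl⟩ ⟨t, rfl⟩
          exact ⟨s + t, by rw [mul_add, add_smul]; simp⟩
        inv_mem' := by
          rintro _ ⟨s, rfl⟩
          exact ⟨-s, by rw [mul_neg, neg_smul]; simp⟩ }
    have : D n ≤ W := by
      rw [Subgroup.commutator_le]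
      rintro _ ⟨i, rfl⟩ _ ⟨j, rfl⟩
      obtain ⟨s, hs⟩ := T_sub_one_dvd i
      refine ⟨s * (j : LaurentPolynomial ℤ), ?_⟩
      have := hT i ((j * n.factorial : ℤ) • a')
      have e : (((j * n.factorial : ℤ) • a').toMul.val : G) = (a ^ n.factorial) ^ j := by
        simp [a', mul_comm j, zpow_mul]
      rw [e] at this
      simp only []
      rw [← this, hs, ← Int.cast_smul_eq_zsmul (LaurentPolynomial ℤ)]
      congr 2
      simp only [d, smul_smul]
      congr 1
      push_cast
      ring
    exact fun g hg => this hg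
  have hd0 : (n₀.factorial • d) = 0 := by
    apply divisible_zero (R := LaurentPolynomial ℤ)
    intro q hq
    obtain ⟨n, hn, hnq⟩ := hFi.exists_gt (n₀ + q)
    have hdvd : n₀.factorial * q ∣ n.factorial := by
      refine dvd_trans ?_ (Nat.factorial_dvd_factorial hnq.le)
      exact dvd_trans (mul_dvd_mul_left _ (Nat.dvd_factorial hq le_rfl))
        (Nat.factorial_mul_factorial_dvd_factorial_add _ _)
    obtain ⟨k, hk⟩ := hdvd
    have hmem : (n₀.factorial • d).toMul.val ∈ D n := by
      rw [show D n = D n₀ from hn.trans hn₀.symm]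
      have := hT 1 (n₀.factorial • a')
      have e : (n₀.factorial • d) = (T 1 - 1 : LaurentPolynomial ℤ) • (n₀.factorial • a') := by
        simp only [d]
        rw [smul_comm]
      rw [e, this]
      apply Subgroup.commutator_mem_commutator
      · exact ⟨1, rfl⟩
      · simp [a']
    obtain ⟨s, hs⟩ := hDn n _ hmem
    refine ⟨k * s, ?_⟩
    have hs' : ((n.factorial : LaurentPolynomial ℤ) * s) • d = n₀.factorial • d := by
      apply Additive.toMul.injective
      exact Subtype.ext hs
    rw [← Nat.cast_smul_eq_nsmul (LaurentPolynomial ℤ)] at hs' ⊢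
    nth_rewrite 2 [← hs']
    rw [smul_smul, hk]
    congr 1
    push_cast
    ring
  apply hinf
  rw [isOfFinOrder_iff_pow_eq_one]
  refine ⟨n₀.factorial, n₀.factorial_pos, ?_⟩
  rw [← hd]
  have := congrArg (fun z : Additive A => z.toMul.val) hd0
  simpa using this

theorem PropKInf.of_surj {G Q : Type*} [Group G] [Group Q] (hG : PropKInf G) (f : G →* Q)
    (hf : Function.Surjective f) : PropKInf Q := by
  intro X
  refine ((hG (X.comap f)).image (Subgroup.map f)).subset ?_
  rintro _ ⟨H, hH, rfl⟩
  refine ⟨⁅X.comap f, H.comap f⁆, ⟨H.comap f, ?_, rfl⟩, ?_⟩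
  · refine Infinite.of_surjective (fun h : H.comap f => (⟨f h, h.2⟩ : H)) ?_
    rintro ⟨h, hh⟩
    obtain ⟨g, rfl⟩ := hf h
    exact ⟨⟨g, hh⟩, rfl⟩
  · rw [Subgroup.map_commutator, Subgroup.map_comap_eq_self_of_surjective hf,
      Subgroup.map_comap_eq_self_of_surjective hf]

theorem PropKInf.subgroup {G : Type*} [Group G] (hG : PropKInf G) (N : Subgroup G) :
    PropKInf N := by
  intro X
  have : Set.InjOn (Subgroup.map N.subtype)
    (Subgroup.map N.subtype ⁻¹' {S : Subgroup G | ∃ H : Subgroup G, Infinite H ∧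
      S = ⁅X.map N.subtype, H⁆}) := (Subgroup.map_injective N.subtype_injective).injOn
  refine ((hG (X.map N.subtype)).preimage this).subset ?_
  rintro _ ⟨H, hH, rfl⟩
  refine ⟨H.map N.subtype, ?_, ?_⟩
  · exact (H.equivMapOfInjective _ N.subtype_injective).toEquiv.infinite_iff.mp hH
  · rw [Subgroup.map_commutator]

/-- periodicity of the commutator subgroup lifts along quotients by periodic subgroups -/
theorem periodic_lift {G : Type*} [Group G] (T : Subgroup G) [T.Normal]
    (hT : ∀ g ∈ T, IsOfFinOrder g) (h : ∀ g ∈ commutator (G ⧸ T), IsOfFinOrder g) :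
    ∀ g ∈ commutator G, IsOfFinOrder g := by
  intro g hg
  have hm : QuotientGroup.mk' T g ∈ commutator (G ⧸ T) := by
    have : (commutator G).map (QuotientGroup.mk' T) ≤ commutator (G ⧸ T) := by
      rw [commutator_def, Subgroup.map_commutator]
      exact Subgroup.commutator_mono le_top le_top
    exact this ⟨g, hg, rfl⟩
  obtain ⟨n, hn, h1⟩ := isOfFinOrder_iff_pow_eq_one.mp (h _ hm)
  rw [← map_pow] at h1
  have h2 : g ^ n ∈ T := by
    rwa [QuotientGroup.mk'_apply, QuotientGroup.eq_one_iff] at h1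
  have := hT _ h2
  rw [isOfFinOrder_pow] at this
  exact this.resolve_right hn.ne'

theorem torsion_quot {G : Type*} [Group G] (hG : PropKInf G) (A : Subgroup G) [hA : A.Normal]
    [IsMulCommutative A] : ∃ T : Subgroup G, ∃ _ : T.Normal, (∀ g ∈ T, IsOfFinOrder g) ∧
      A.map (QuotientGroup.mk' T) ≤ Subgroup.center (G ⧸ T) := by
  let T : Subgroup G := (CommGroup.torsion A).map A.subtype
  have hTmem : ∀ g, g ∈ T ↔ g ∈ A ∧ IsOfFinOrder g := by
    intro g
    constructor
    · rintro ⟨b, hb, rfl⟩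
      exact ⟨b.2, isOfFinOrder_sub_coe.mpr hb⟩
    · rintro ⟨h1, h2⟩
      exact ⟨⟨g, h1⟩, isOfFinOrder_sub_coe.mp h2, rfl⟩
  have hTn : T.Normal := by
    constructor
    intro n hn g
    rw [hTmem] at hn ⊢
    refine ⟨hA.conj_mem _ hn.1 g, ?_⟩
    simpa using (MulAut.conj g).toMonoidHom.isOfFinOrder hn.2
  refine ⟨T, hTn, fun g hg => ((hTmem g).mp hg).2, ?_⟩
  rintro _ ⟨a, ha, rfl⟩
  rw [Subgroup.mem_center_iff]
  intro y
  obtain ⟨x, rfl⟩ := QuotientGroup.mk'_surjective T y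
  rw [← commutatorElement_eq_one_iff_mul_comm, ← map_commutatorElement, QuotientGroup.mk'_apply,
    QuotientGroup.eq_one_iff, hTmem]
  refine ⟨?_, step_one hG A x a ha⟩
  rw [commutatorElement_def]
  exact A.mul_mem (hA.conj_mem a ha x) (A.inv_mem ha)

theorem class_two {G : Type*} [Group G] (hG : PropKInf G)
    (hc : commutator G ≤ Subgroup.center G) : ∀ g ∈ commutator G, IsOfFinOrder g := by
  have key : ∀ x y : G, IsOfFinOrder ⁅x, y⁆ := by
    intro x y
    by_contra hinf
    let φ : G → G → G := fun u v => ⁅u, v⁆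
    have hz : ∀ u v w : G, Commute ⁅u, v⁆ w := by
      intro u v w
      have := hc (Subgroup.commutator_mem_commutator (Subgroup.mem_top u) (Subgroup.mem_top v))
      exact ((Subgroup.mem_center_iff.mp this) w).symm
    have hr : ∀ u v w : G, ⁅u, v * w⁆ = ⁅u, v⁆ * ⁅u, w⁆ := by
      intro u v w
      have h := (hz u w v).eq
      calc ⁅u, v * w⁆ = ⁅u, v⁆ * (v * ⁅u, w⁆ * v⁻¹) := by
            simp only [commutatorElement_def]; group
        _ = _ := by rw [← h]; group
    have hl : ∀ u v w : G, ⁅u * v, w⁆ = ⁅u, w⁆ * ⁅v, w⁆ := by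
      intro u v w
      rw [← commutatorElement_inv, hr, mul_inv_rev, commutatorElement_inv, commutatorElement_inv]
      exact (hz v w _).eq
    let R : G → G →* G := fun u => MonoidHom.mk' (fun v => ⁅u, v⁆) (hr u)
    let L : G → G →* G := fun w => MonoidHom.mk' (fun v => ⁅v, w⁆) (fun u v => hl u v w)
    have hR : ∀ u v (n : ℤ), ⁅u, v ^ n⁆ = ⁅u, v⁆ ^ n := fun u v n => map_zpow (R u) v n
    have hL : ∀ u v (n : ℤ), ⁅u ^ n, v⁆ = ⁅u, v⁆ ^ n := fun u v n => map_zpow (L v) u n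
    have hy : ¬ IsOfFinOrder y := fun h => hinf ((R x).isOfFinOrder h)
    refine (Set.infinite_of_injective_forall_mem (α := ℕ)
      (f := fun n => Subgroup.zpowers (⁅x, y⁆ ^ (n + 1))) ?_ ?_) (hG (Subgroup.zpowers x))
    · intro m n hmn
      simp only at hmn
      have hinj := injective_zpow_iff_not_isOfFinOrder.mpr hinf
      have aux : ∀ m n : ℕ, Subgroup.zpowers (⁅x, y⁆ ^ (m + 1)) = Subgroup.zpowers (⁅x, y⁆ ^ (n + 1))
          → n + 1 ∣ m + 1 := by
        intro m n h
        have h1 : ⁅x, y⁆ ^ (m + 1) ∈ Subgroup.zpowers (⁅x, y⁆ ^ (n + 1)) := by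
          rw [← h]; exact Subgroup.mem_zpowers _
        obtain ⟨k, hk⟩ := h1
        simp only [← zpow_natCast, ← zpow_mul] at hk
        have := hinj hk
        exact Int.natCast_dvd_natCast.mp ⟨k, this.symm⟩
      have := Nat.dvd_antisymm (aux m n hmn) (aux n m hmn.symm)
      omega
    · intro n
      refine ⟨Subgroup.zpowers (y ^ (n + 1)), ?_, ?_⟩
      · rw [← SetLike.coe_sort_coe, Set.infinite_coe_iff, infinite_zpowers, isOfFinOrder_pow]
        simp [hy]
      · apply le_antisymm
        · rw [Subgroup.zpowers_le, ← zpow_natCast ⁅x, y⁆, ← hR, zpow_natCast]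
          exact Subgroup.commutator_mem_commutator (Subgroup.mem_zpowers _)
            (Subgroup.mem_zpowers _)
        · rw [Subgroup.commutator_le]
          rintro _ ⟨i, rfl⟩ _ ⟨j, rfl⟩
          refine ⟨i * j, ?_⟩
          simp only [hR, hL, ← zpow_natCast, ← zpow_mul]
          congr 1
          ring
  intro g hg
  rw [commutator_eq_closure] at hg
  induction hg using Subgroup.closure_induction with
  | mem g h => obtain ⟨x, y, rfl⟩ := h; exact key x y
  | one => exact IsOfFinOrder.one
  | mul u v hu hv h1 h2 =>
    rw [← commutator_eq_closure] at hu
    have : Commute u v := ((Subgroup.mem_center_iff.mp (hc hu)) v).symm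
    exact this.isOfFinOrder_mul h1 h2
  | inv u hu h => exact h.inv

theorem commutator_map_quot {G : Type*} [Group G] (T : Subgroup G) [T.Normal] :
    (commutator G).map (QuotientGroup.mk' T) = commutator (G ⧸ T) := by
  rw [commutator_def, commutator_def, Subgroup.map_commutator,
    Subgroup.map_top_of_surjective _ (QuotientGroup.mk'_surjective T)]

theorem isMulComm_of_commutator_bot {G : Type*} [Group G] (A : Subgroup G) (h : ⁅A, A⁆ = ⊥) :
    IsMulCommutative A := by
  rw [Subgroup.commutator_eq_bot_iff_le_centralizer] at h
  refine ⟨⟨fun a b => Subtype.ext ?_⟩⟩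
  exact (Subgroup.mem_centralizer_iff.mp (h a.2) b b.2).symm

theorem metab {G : Type*} [Group G] (hG : PropKInf G)
    (h : ⁅commutator G, commutator G⁆ = ⊥) : ∀ g ∈ commutator G, IsOfFinOrder g := by
  haveI := isMulComm_of_commutator_bot _ h
  obtain ⟨T, hTn, hT, hc⟩ := torsion_quot hG (commutator G)
  apply periodic_lift T hT
  apply class_two (hG.of_surj _ (QuotientGroup.mk'_surjective T))
  rwa [← commutator_map_quot]

theorem derived_map {G : Type*} [Group G] (n : ℕ) :
    (derivedSeries (commutator G) n).map (commutator G).subtype = derivedSeries G (n + 1) := by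
  induction n with
  | zero => rw [derivedSeries_zero, ← MonoidHom.range_eq_map, Subgroup.range_subtype]; rfl
  | succ n ih => rw [derivedSeries_succ, Subgroup.map_commutator, ih, ← derivedSeries_succ]

/-- Periodicity transfers from the commutator of the type `N` to `⁅N, N⁆`. -/
theorem periodic_sub {G : Type*} [Group G] (N : Subgroup G)
    (h : ∀ g ∈ commutator N, IsOfFinOrder g) : ∀ g ∈ ⁅N, N⁆, IsOfFinOrder g := by
  intro g hg
  have : ⁅N, N⁆ = (commutator N).map N.subtype := by
    rw [commutator_def, Subgroup.map_commutator, ← MonoidHom.range_eq_map, Subgroup.range_subtype]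
  rw [this] at hg
  obtain ⟨b, hb, rfl⟩ := hg
  exact N.subtype.isOfFinOrder (h b hb)

theorem sol_case (n : ℕ) : ∀ (G : Type u) [Group G], PropKInf G → derivedSeries G n = ⊥ →
    ∀ g ∈ commutator G, IsOfFinOrder g := by
  induction n with
  | zero =>
    intro G _ hG h g hg
    have : g ∈ derivedSeries G 0 := Subgroup.mem_top g
    rw [h, Subgroup.mem_bot] at this
    rw [this]; exact IsOfFinOrder.one
  | succ n ih =>
    intro G _ hG h
    have h1 : derivedSeries (commutator G) n = ⊥ := by
      rw [← derived_map] at h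
      exact (Subgroup.map_eq_bot_iff_of_injective _ (commutator G).subtype_injective).mp h
    have h2 := periodic_sub _ (ih _ (hG.subgroup _) h1)
    apply periodic_lift ⁅commutator G, commutator G⁆ h2
    apply metab (hG.of_surj _ (QuotientGroup.mk'_surjective _))
    rw [← commutator_map_quot, ← Subgroup.map_commutator]
    exact QuotientGroup.map_mk'_self _

theorem schur {G : Type*} [Group G] (A : Subgroup G) (hA : A.FiniteIndex)
    (hc : A ≤ Subgroup.center G) : ∀ g ∈ commutator G, IsOfFinOrder g := by
  haveI : (Subgroup.center G).FiniteIndex := Subgroup.finiteIndex_of_le hc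
  haveI : Finite (commutatorSet G) := by
    let F : (G ⧸ Subgroup.center G) × (G ⧸ Subgroup.center G) → G :=
      fun p => ⁅p.1.out, p.2.out⁆
    refine (Set.finite_range F).subset ?_
    rintro _ ⟨x, y, rfl⟩
    refine ⟨((x : G ⧸ Subgroup.center G), (y : G ⧸ Subgroup.center G)), ?_⟩
    obtain ⟨u, hu⟩ := QuotientGroup.mk_out_eq_mul (Subgroup.center G) x
    obtain ⟨v, hv⟩ := QuotientGroup.mk_out_eq_mul (Subgroup.center G) y
    simp only [F, hu, hv]
    have hu' := Subgroup.mem_center_iff.mp u.2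
    have hv' := Subgroup.mem_center_iff.mp v.2
    simp only [commutatorElement_def, mul_inv_rev]
    have e1 : x * (u : G) * (y * v) = x * y * v * u := by
      rw [mul_assoc x, ← hu', ← mul_assoc, ← mul_assoc]
    have e2 : x * y * (v : G) * x⁻¹ = x * y * x⁻¹ * v := by
      rw [mul_assoc (x * y), ← hv', ← mul_assoc]
    calc x * (u : G) * (y * v) * ((u : G)⁻¹ * x⁻¹) * ((v : G)⁻¹ * y⁻¹)
        = (x * y * (v : G) * x⁻¹) * ((v : G)⁻¹ * y⁻¹) := by rw [e1]; group
      _ = _ := by rw [e2]; group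
  intro g hg
  exact isOfFinOrder_sub_coe.mpr (isOfFinOrder_of_finite (⟨g, hg⟩ : commutator G))

end helpers

theorem stmt_19 (G : Type*) [Group G] (hsf : SolubleByFinite G)
    (hG : PropKInf G) : ∀ g ∈ commutator G, IsOfFinOrder g := by
  obtain ⟨N, hN, hs, hfi⟩ := hsf
  obtain ⟨n, hn⟩ := hs.solvable
  have h2 := periodic_sub _ (sol_case n _ (hG.subgroup N) hn)
  apply periodic_lift ⁅N, N⁆ h2
  have hQ := hG.of_surj _ (QuotientGroup.mk'_surjective ⁅N, N⁆)
  set B := N.map (QuotientGroup.mk' ⁅N, N⁆) with hB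
  have hBc : ⁅B, B⁆ = ⊥ := by
    rw [hB, ← Subgroup.map_commutator]
    exact QuotientGroup.map_mk'_self _
  have := isMulComm_of_commutator_bot _ hBc
  have : B.Normal := hN.map _ (QuotientGroup.mk'_surjective _)
  have hBfi : B.FiniteIndex :=
    ⟨ne_zero_of_dvd_ne_zero hfi.index_ne_zero
      (Subgroup.index_map_dvd _ (QuotientGroup.mk'_surjective _))⟩
  obtain ⟨T, hTn, hT, hc⟩ := torsion_quot hQ B
  apply periodic_lift T hT
  refine schur _ ⟨?_⟩ hc
  exact ne_zero_of_dvd_ne_zero hBfi.index_ne_zero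
      (Subgroup.index_map_dvd _ (QuotientGroup.mk'_surjective _))
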